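/- Let φ > 0 and let s be a positive integer. A vector v ∈ ℝ^n belongs to T(φ,s) if and only if v lies in the convex hull of U(φ,s,v). In particular, every v ∈ T(φ,s) can be expressed as v = ∑_{i=1}^N γ_i·u_i for some finite N, where each u_i ∈ U(φ,s,v), each γ_i ∈ [0,1], and ∑_{i=1}^N γ_i = 1. -/

import Mathlib

open scoped BigOperators

noncomputable section

namespace SparseRep

/-- The polytope `T(φ,s) = {v : ‖v‖_∞ ≤ φ, ‖v‖_1 ≤ s·φ}`. -/
def Tset (n : ℕ) (φ : ℝ) (s : ℕ) : Set (Fin n → ℝ) :=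
  {v | (∀ i, |v i| ≤ φ) ∧ (∑ i, |v i|) ≤ (s : ℝ) * φ}

/-- The set of sparse vectors
`U(φ,s,v) = {u : supp(u) ⊆ supp(v), ‖u‖_0 ≤ s, ‖u‖_1 = ‖v‖_1, ‖u‖_∞ ≤ φ}`. -/
def Uset (n : ℕ) (φ : ℝ) (s : ℕ) (v : Fin n → ℝ) : Set (Fin n → ℝ) :=
  {u | (∀ i, u i ≠ 0 → v i ≠ 0) ∧
    (Finset.univ.filter fun i => u i ≠ 0).card ≤ s ∧
    (∑ i, |u i|) = (∑ i, |v i|) ∧ ∀ i, |u i| ≤ φ}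

end SparseRep

namespace SparseRep

/-- The coordinates of `v` whose absolute value lies strictly between `0` and `φ`. -/
def fractional {n : ℕ} (φ : ℝ) (v : Fin n → ℝ) : Finset (Fin n) :=
  Finset.univ.filter fun i => v i ≠ 0 ∧ |v i| < φ

/-- Moves absolute value `t` from coordinate `j` of `v` to coordinate `i`, keeping signs. -/
def transfer {n : ℕ} (v : Fin n → ℝ) (i j : Fin n) (t : ℝ) : Fin n → ℝ :=
  v + t • (Pi.single i (Real.sign (v i)) - Pi.single j (Real.sign (v j)))

lemma abs_add_mul_sign {x t : ℝ} (hx : x ≠ 0) (ht : 0 ≤ |x| + t) :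
    |x + t * Real.sign x| = |x| + t := by
  rcases lt_or_gt_of_ne hx with h | h
  · rw [abs_of_neg h] at ht ⊢
    rw [Real.sign_of_neg h, abs_of_nonpos (by linarith)]
    ring
  · rw [abs_of_pos h] at ht ⊢
    rw [Real.sign_of_pos h, abs_of_nonneg (by linarith)]
    ring

lemma convex_Tset (n : ℕ) (φ : ℝ) (s : ℕ) : Convex ℝ (Tset n φ s) := by
  intro x hx y hy a b ha hb hab
  have key (i : Fin n) : |(a • x + b • y) i| ≤ a * |x i| + b * |y i| := by
    simpa [abs_mul, abs_of_nonneg ha, abs_of_nonneg hb] using abs_add_le (a * x i) (b * y i)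
  refine ⟨fun i => (key i).trans ?_, (Finset.sum_le_sum fun i _ => key i).trans ?_⟩
  · exact convex_Iic φ (hx.1 i) (hy.1 i) ha hb hab
  · rw [Finset.sum_add_distrib, ← Finset.mul_sum, ← Finset.mul_sum]
    exact convex_Iic ((s : ℝ) * φ) hx.2 hy.2 ha hb hab

lemma Uset_subset_Tset {n : ℕ} {φ : ℝ} (hφ : 0 < φ) (s : ℕ) (v : Fin n → ℝ) :
    Uset n φ s v ⊆ Tset n φ s := by
  rintro u ⟨-, hcard, -, hsup⟩
  refine ⟨hsup, ?_⟩
  calc ∑ i, |u i| = ∑ i with u i ≠ 0, |u i| :=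
        (Finset.sum_filter_of_ne fun i _ h => abs_ne_zero.mp h).symm
    _ ≤ (Finset.univ.filter fun i => u i ≠ 0).card • φ :=
        Finset.sum_le_card_nsmul _ _ _ fun i _ => hsup i
    _ ≤ (s : ℝ) * φ := by
        rw [nsmul_eq_mul]
        gcongr

lemma Uset_subset_Uset {n : ℕ} {φ : ℝ} {s : ℕ} {u v : Fin n → ℝ}
    (hsupp : ∀ i, u i ≠ 0 → v i ≠ 0) (hsum : ∑ i, |u i| = ∑ i, |v i|) :
    Uset n φ s u ⊆ Uset n φ s v :=
  fun _ hw => ⟨fun i hi => hsupp i (hw.1 i hi), hw.2.1, hw.2.2.1.trans hsum, hw.2.2.2⟩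

lemma mem_Uset_self_of_card_fractional_le_one {n : ℕ} {φ : ℝ} (hφ : 0 < φ) {s : ℕ}
    {v : Fin n → ℝ} (hv : v ∈ Tset n φ s) (hcard : (fractional φ v).card ≤ 1) :
    v ∈ Uset n φ s v := by
  refine ⟨fun _ h => h, ?_, rfl, hv.1⟩
  set A := Finset.univ.filter fun i => v i ≠ 0 with hA
  have hFA : fractional φ v ⊆ A := fun i hi => by
    simp only [fractional, Finset.mem_filter, hA] at hi ⊢
    exact ⟨hi.1, hi.2.1⟩
  have hsum : ∑ i ∈ A, |v i| ≤ s * φ := by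
    rw [Finset.sum_filter_of_ne fun i _ h => abs_ne_zero.mp h]
    exact hv.2
  have hfull : ∀ i ∈ A \ fractional φ v, |v i| = φ := fun i hi => by
    simp only [hA, fractional, Finset.mem_sdiff, Finset.mem_filter, Finset.mem_univ,
      true_and, not_and, not_lt] at hi
    exact le_antisymm (hv.1 i) (hi.2 hi.1)
  rw [← Finset.sum_sdiff hFA, Finset.sum_congr rfl hfull, Finset.sum_const, nsmul_eq_mul] at hsum
  rw [← Finset.card_sdiff_add_card_eq_card hFA]
  rcases (fractional φ v).eq_empty_or_nonempty with hF | hF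
  · rw [hF] at hsum ⊢
    have : ((A \ ∅).card : ℝ) ≤ s := le_of_mul_le_mul_right (by simpa using hsum) hφ
    simpa using this
  · have hpos : 0 < ∑ i ∈ fractional φ v, |v i| := Finset.sum_pos (fun i hi => by
      simp only [fractional, Finset.mem_filter] at hi
      exact abs_pos.mpr hi.2.1) hF
    have : ((A \ fractional φ v).card : ℝ) < s :=
      lt_of_mul_lt_mul_right (by linarith) hφ.le
    have : (A \ fractional φ v).card < s := by exact_mod_cast this
    omega

lemma abs_transfer {n : ℕ} {v : Fin n → ℝ} {i j : Fin n} (hij : i ≠ j) (hi : v i ≠ 0)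
    (hj : v j ≠ 0) {t : ℝ} (ht : 0 ≤ t) (htj : t ≤ |v j|) (k : Fin n) :
    |transfer v i j t k| =
      |v k| + t * ((Pi.single i 1 : Fin n → ℝ) k - (Pi.single j 1 : Fin n → ℝ) k) := by
  by_cases hki : k = i
  · subst hki
    simpa [transfer, hij] using abs_add_mul_sign hi (t := t) (by positivity)
  by_cases hkj : k = j
  · subst hkj
    simpa [transfer, hki] using abs_add_mul_sign hj (t := -t) (by linarith)
  · simp [transfer, hki, hkj]

lemma exists_transfer {n : ℕ} {φ : ℝ} {s : ℕ} {v : Fin n → ℝ} (hv : v ∈ Tset n φ s)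
    {i j : Fin n} (hi : i ∈ fractional φ v) (hj : j ∈ fractional φ v) (hij : i ≠ j) :
    ∃ t : ℝ, 0 < t ∧ transfer v i j t ∈ Tset n φ s ∧
      Uset n φ s (transfer v i j t) ⊆ Uset n φ s v ∧
      (fractional φ (transfer v i j t)).card < (fractional φ v).card := by
  have hi' := hi
  have hj' := hj
  simp only [fractional, Finset.mem_filter, Finset.mem_univ, true_and] at hi' hj'
  set t := min (φ - |v i|) |v j|
  have hpos : 0 < t := lt_min (by linarith [hi'.2]) (abs_pos.mpr hj'.1)
  have hti : t ≤ φ - |v i| := min_le_left _ _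
  have htj : t ≤ |v j| := min_le_right _ _
  have habs := abs_transfer hij hi'.1 hj'.1 hpos.le htj
  have habs_i : |transfer v i j t i| = |v i| + t := by simpa [hij] using habs i
  have habs_j : |transfer v i j t j| = |v j| - t := by
    simpa [hij.symm, sub_eq_add_neg] using habs j
  have hne (k : Fin n) (hki : k ≠ i) (hkj : k ≠ j) : transfer v i j t k = v k := by
    simp [transfer, hki, hkj]
  have hsum : ∑ k, |transfer v i j t k| = ∑ k, |v k| := by
    simp [habs, Finset.sum_add_distrib, ← Finset.mul_sum]
  refine ⟨t, hpos, ⟨fun k => ?_, hsum.trans_le hv.2⟩, Uset_subset_Uset (fun k hk => ?_) hsum,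
    Finset.card_lt_card ((Finset.ssubset_iff_of_subset fun k hk => ?_).mpr ?_)⟩
  · by_cases hki : k = i
    · subst hki; linarith
    by_cases hkj : k = j
    · subst hkj; linarith [hv.1 k]
    · rw [hne k hki hkj]; exact hv.1 k
  · by_cases hki : k = i
    · exact hki ▸ hi'.1
    by_cases hkj : k = j
    · exact hkj ▸ hj'.1
    · rwa [hne k hki hkj] at hk
  · by_cases hki : k = i
    · exact hki ▸ hi
    by_cases hkj : k = j
    · exact hkj ▸ hj
    · simpa [fractional, hne k hki hkj] using hk
  · rcases min_choice (φ - |v i|) |v j| with h | h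
    · refine ⟨i, hi, fun hmem => ?_⟩
      simp only [fractional, Finset.mem_filter] at hmem
      linarith [hmem.2.2]
    · refine ⟨j, hj, fun hmem => ?_⟩
      simp only [fractional, Finset.mem_filter] at hmem
      exact hmem.2.1 (abs_eq_zero.mp (by linarith))

lemma mem_segment_transfer {n : ℕ} (v : Fin n → ℝ) (i j : Fin n) {a b : ℝ} (ha : 0 < a)
    (hb : 0 < b) : v ∈ segment ℝ (transfer v i j a) (transfer v j i b) := by
  have hab : a + b ≠ 0 := by positivity
  refine ⟨b / (a + b), a / (a + b), by positivity, by positivity, by field_simp; ring, ?_⟩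
  ext k
  simp only [transfer, Pi.add_apply, Pi.smul_apply, Pi.sub_apply, smul_eq_mul]
  field_simp
  ring

lemma Tset_mem_convexHull_Uset {n : ℕ} {φ : ℝ} (hφ : 0 < φ) {s : ℕ} {v : Fin n → ℝ}
    (hv : v ∈ Tset n φ s) : v ∈ convexHull ℝ (Uset n φ s v) := by
  induction hm : (fractional φ v).card using Nat.strong_induction_on generalizing v with
  | _ m ih =>
    subst hm
    rcases le_or_gt (fractional φ v).card 1 with hcard | hcard
    · exact subset_convexHull ℝ _ (mem_Uset_self_of_card_fractional_le_one hφ hv hcard)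
    · obtain ⟨i, hi, j, hj, hij⟩ := Finset.one_lt_card.mp hcard
      obtain ⟨a, ha, haT, haU, hac⟩ := exists_transfer hv hi hj hij
      obtain ⟨b, hb, hbT, hbU, hbc⟩ := exists_transfer hv hj hi hij.symm
      exact (convex_convexHull ℝ _).segment_subset
        (convexHull_mono haU (ih _ hac haT rfl)) (convexHull_mono hbU (ih _ hbc hbT rfl))
        (mem_segment_transfer v i j ha hb)

end SparseRep

theorem sparse_representation_of_polytope (n : ℕ) (φ : ℝ) (hφ : 0 < φ)
    (s : ℕ) (hs : 0 < s) (v : Fin n → ℝ) :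
    (v ∈ SparseRep.Tset n φ s ↔ v ∈ convexHull ℝ (SparseRep.Uset n φ s v)) ∧
      (v ∈ SparseRep.Tset n φ s →
        ∃ (N : ℕ) (γ : Fin N → ℝ) (u : Fin N → Fin n → ℝ),
          (∀ i, u i ∈ SparseRep.Uset n φ s v) ∧ (∀ i, γ i ∈ Set.Icc (0 : ℝ) 1) ∧
            (∑ i, γ i) = 1 ∧ v = ∑ i, γ i • u i) := by
  refine ⟨⟨SparseRep.Tset_mem_convexHull_Uset hφ, fun hv => convexHull_min
    (SparseRep.Uset_subset_Tset hφ s v) (SparseRep.convex_Tset n φ s) hv⟩, fun hv => ?_⟩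
  obtain ⟨ι, _, w, z, hw, hw1, hz, hsum⟩ := mem_convexHull_iff_exists_fintype.mp
    (SparseRep.Tset_mem_convexHull_Uset hφ hv)
  let e := (Fintype.equivFin ι).symm
  refine ⟨Fintype.card ι, w ∘ e, z ∘ e, fun i => hz _, fun i => ⟨hw _, ?_⟩, ?_, ?_⟩
  · exact hw1 ▸ Finset.single_le_sum (fun k _ => hw k) (Finset.mem_univ (e i))
  · exact (e.sum_comp w).trans hw1
  · exact hsum.symm.trans (e.sum_comp fun k => w k • z k).symm
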